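/- Suppose λ + μ > 0. Fix a finite closed interval I ⊂ ℝ and a > 0, let E = I × [0,a], and define the measure φ_E(A) = Leb(A ∩ E) (two-dimensional Lebesgue measure of the intersection with E). Then for every x ∈ S and every Borel set B ⊆ S with φ_E(B) > 0, there exists a finite integer n ≥ 1 such that Pⁿ(x, B) > 0. In particular the chain is φ_E-irreducible. -/

import Mathlib

open MeasureTheory ProbabilityTheory Filter

noncomputable section

/-- One step of the dynamics, given current state `x = (R, Z)` and noise `n`:
`R' = R − λ·max(−R,0) + λ(λ+μ)Z + max(min(ζ, r* − R), −ξ) + n`,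
`Z' = max(−R,0) + (1−λ−μ)Z`. -/
def step (lam mu zeta xi rstar : ℝ) (x : ℝ × ℝ) (n : ℝ) : ℝ × ℝ :=
  (x.1 - lam * max (-x.1) 0 + lam * (lam + mu) * x.2
      + max (min zeta (rstar - x.1)) (-xi) + n,
   max (-x.1) 0 + (1 - lam - mu) * x.2)

/-- The Gaussian noise distribution `N(0, σ²)`. -/
def noise (sigma : ℝ) : Measure ℝ := gaussianReal 0 (sigma ^ 2).toNNReal

/-- The one-step transition kernel `P(x, ·)`: the law of `step x N` with `N ~ N(0, σ²)`. -/
def kerP (lam mu zeta xi rstar sigma : ℝ) (x : ℝ × ℝ) : Measure (ℝ × ℝ) :=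
  (noise sigma).map (step lam mu zeta xi rstar x)

/-- The `n`-step transition kernel `Pⁿ(x, ·)`. -/
def kerPn (lam mu zeta xi rstar sigma : ℝ) : ℕ → (ℝ × ℝ) → Measure (ℝ × ℝ)
  | 0, x => Measure.dirac x
  | n + 1, x => (kerP lam mu zeta xi rstar sigma x).bind (kerPn lam mu zeta xi rstar sigma n)

/-- Total variation distance between two measures: sup over Borel sets of the
absolute difference. -/
def tvDist (m1 m2 : Measure (ℝ × ℝ)) : ℝ :=
  ⨆ B : { B : Set (ℝ × ℝ) // MeasurableSet B }, |(m1 B).toReal - (m2 B).toReal|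

end

/-- The second coordinate after one step from `x`; it does not depend on the noise. -/
def nextZ (lam mu : ℝ) (x : ℝ × ℝ) : ℝ := max (-x.1) 0 + (1 - lam - mu) * x.2

/-- The first coordinate after one noiseless step from `x`. -/
def drift (lam mu zeta xi rstar : ℝ) (x : ℝ × ℝ) : ℝ :=
  x.1 - lam * max (-x.1) 0 + lam * (lam + mu) * x.2 + max (min zeta (rstar - x.1)) (-xi)

theorem nextZ_step (lam mu zeta xi rstar : ℝ) (x : ℝ × ℝ) (n : ℝ) :
    nextZ lam mu (step lam mu zeta xi rstar x n) =
      max (-(drift lam mu zeta xi rstar x + n)) 0 + (1 - lam - mu) * nextZ lam mu x := rfl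

theorem measurable_step (lam mu zeta xi rstar : ℝ) :
    Measurable fun p : (ℝ × ℝ) × ℝ => step lam mu zeta xi rstar p.1 p.2 := by
  unfold step
  fun_prop

theorem measurable_step_right (lam mu zeta xi rstar : ℝ) (x : ℝ × ℝ) :
    Measurable (step lam mu zeta xi rstar x) :=
  (measurable_step lam mu zeta xi rstar).comp measurable_prodMk_left

instance isProbabilityMeasure_noise (sigma : ℝ) : IsProbabilityMeasure (noise sigma) := by
  unfold noise
  infer_instance

theorem volume_absolutelyContinuous_noise {sigma : ℝ} (hsigma : 0 < sigma) :
    volume ≪ noise sigma := by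
  refine gaussianReal_absolutelyContinuous' 0 ?_
  simp [hsigma.ne']

theorem measurable_kerP (lam mu zeta xi rstar sigma : ℝ) :
    Measurable (kerP lam mu zeta xi rstar sigma) := by
  refine Measure.measurable_of_measurable_coe _ fun s hs => ?_
  have h (x : ℝ × ℝ) : kerP lam mu zeta xi rstar sigma x s = noise sigma
      (Prod.mk x ⁻¹' ((fun p : (ℝ × ℝ) × ℝ => step lam mu zeta xi rstar p.1 p.2) ⁻¹' s)) :=
    Measure.map_apply (measurable_step_right lam mu zeta xi rstar x) hs
  simp only [h]
  exact measurable_measure_prodMk_left (measurable_step lam mu zeta xi rstar hs)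

theorem measurable_kerPn (lam mu zeta xi rstar sigma : ℝ) (n : ℕ) :
    Measurable (kerPn lam mu zeta xi rstar sigma n) := by
  induction n with
  | zero => exact Measure.measurable_dirac
  | succ n ih => exact (Measure.measurable_bind' ih).comp (measurable_kerP ..)

theorem kerPn_succ_apply (lam mu zeta xi rstar sigma : ℝ) (n : ℕ) (x : ℝ × ℝ)
    {B : Set (ℝ × ℝ)} (hB : MeasurableSet B) :
    kerPn lam mu zeta xi rstar sigma (n + 1) x B =
      ∫⁻ t, kerPn lam mu zeta xi rstar sigma n (step lam mu zeta xi rstar x t) B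
        ∂noise sigma := by
  have hm := measurable_kerPn lam mu zeta xi rstar sigma n
  rw [kerPn, Measure.bind_apply hB hm.aemeasurable]
  exact lintegral_map ((Measure.measurable_coe hB).comp hm) (measurable_step_right ..)

/-- If a set of noise values of positive Lebesgue measure leads to states from which `B` is
reached in `n` steps, then `B` is reached in `n + 1` steps. -/
theorem kerPn_succ_pos (lam mu zeta xi rstar : ℝ) {sigma : ℝ} (hsigma : 0 < sigma) (n : ℕ)
    (x : ℝ × ℝ) {B : Set (ℝ × ℝ)} (hB : MeasurableSet B) {U : Set ℝ} (hU : volume U ≠ 0)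
    (h : ∀ t ∈ U, 0 < kerPn lam mu zeta xi rstar sigma n (step lam mu zeta xi rstar x t) B) :
    0 < kerPn lam mu zeta xi rstar sigma (n + 1) x B := by
  rw [kerPn_succ_apply _ _ _ _ _ _ _ _ hB, pos_iff_ne_zero]
  intro h0
  replace h0 := (lintegral_eq_zero_iff (((Measure.measurable_coe hB).comp
    (measurable_kerPn lam mu zeta xi rstar sigma n)).comp
      (measurable_step_right lam mu zeta xi rstar x))).1 h0
  refine hU (measure_mono_null (fun t ht => ?_)
    (ae_iff.1 ((volume_absolutelyContinuous_noise hsigma).ae_le h0)))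
  exact (h t ht).ne'

theorem kerPn_one_pos (lam mu zeta xi rstar : ℝ) {sigma : ℝ} (hsigma : 0 < sigma)
    (x : ℝ × ℝ) {B : Set (ℝ × ℝ)} (hB : MeasurableSet B)
    (h : volume ((fun r : ℝ => (r, nextZ lam mu x)) ⁻¹' B) ≠ 0) :
    0 < kerPn lam mu zeta xi rstar sigma 1 x B := by
  refine kerPn_succ_pos lam mu zeta xi rstar hsigma 0 x hB
    (U := (fun t => drift lam mu zeta xi rstar x + t) ⁻¹'
      ((fun r : ℝ => (r, nextZ lam mu x)) ⁻¹' B)) ?_ fun t ht => ?_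
  · rwa [measure_preimage_add]
  · have : step lam mu zeta xi rstar x t ∈ B := ht
    simp [kerPn, Measure.dirac_apply' _ hB, this]

/-- In two steps the chain reaches every set of positive Lebesgue measure above the height
`(1 - lam - mu) * nextZ lam mu x`. -/
theorem kerPn_two_pos (lam mu zeta xi rstar : ℝ) {sigma : ℝ} (hsigma : 0 < sigma)
    (x : ℝ × ℝ) {B : Set (ℝ × ℝ)} (hB : MeasurableSet B)
    (h : volume (B ∩ {p | (1 - lam - mu) * nextZ lam mu x < p.2}) ≠ 0) :
    0 < kerPn lam mu zeta xi rstar sigma 2 x B := by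
  set c := (1 - lam - mu) * nextZ lam mu x with hc
  set d := drift lam mu zeta xi rstar x
  set T : Set ℝ := {z | c < z ∧ volume ((fun r : ℝ => (r, z)) ⁻¹' B) ≠ 0}
  have hT0 : volume T ≠ 0 := by
    intro h0
    refine h ?_
    have hms : MeasurableSet (B ∩ {p : ℝ × ℝ | c < p.2}) :=
      hB.inter (measurableSet_lt measurable_const measurable_snd)
    rw [Measure.volume_eq_prod, Measure.prod_apply_symm hms,
      lintegral_eq_zero_iff (measurable_measure_prodMk_right hms)]
    refine ae_iff.2 (measure_mono_null (fun z hz => ?_) h0)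
    by_contra hzT
    refine hz ?_
    by_cases hcz : c < z
    · have : volume ((fun r : ℝ => (r, z)) ⁻¹' B) = 0 := by
        by_contra hne
        exact hzT ⟨hcz, hne⟩
      exact measure_mono_null (fun r hr => hr.1) this
    · have : (fun r : ℝ => (r, z)) ⁻¹' (B ∩ {p : ℝ × ℝ | c < p.2}) = ∅ :=
        Set.eq_empty_of_forall_notMem fun r hr => hcz hr.2
      simp [this]
  refine kerPn_succ_pos lam mu zeta xi rstar hsigma 1 x hB
    (U := (fun t => (c - d) - t) ⁻¹' T) ?_ fun t ht => ?_
  · rwa [((volume : Measure ℝ).measurePreserving_sub_left (c - d)).measure_preimage_emb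
      (MeasurableEquiv.subLeft (c - d)).measurableEmbedding]
  · refine kerPn_one_pos lam mu zeta xi rstar hsigma _ hB ?_
    have hlt : c < c - d - t := ht.1
    have hz : nextZ lam mu (step lam mu zeta xi rstar x t) = c - d - t := by
      rw [nextZ_step, ← hc, max_eq_left (by linarith)]
      ring
    rw [hz]
    exact ht.2

/-- Noise keeping the first coordinate nonnegative multiplies the height by `1 - lam - mu` at
each step, so sets above `ε` are reached once the height has decayed below `ε`. -/
theorem kerPn_pos_of_pow_lt (lam mu zeta xi rstar : ℝ) {sigma : ℝ} (hsigma : 0 < sigma)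
    {B : Set (ℝ × ℝ)} (hB : MeasurableSet B) {ε : ℝ}
    (h : volume (B ∩ {p | ε < p.2}) ≠ 0) (k : ℕ) (x : ℝ × ℝ)
    (hx : (1 - lam - mu) ^ (k + 1) * nextZ lam mu x ≤ ε) :
    0 < kerPn lam mu zeta xi rstar sigma (k + 2) x B := by
  induction k generalizing x with
  | zero =>
    refine kerPn_two_pos lam mu zeta xi rstar hsigma x hB fun h0 => h ?_
    rw [zero_add, pow_one] at hx
    exact measure_mono_null (fun p hp => And.intro hp.1 (hx.trans_lt hp.2)) h0
  | succ k ih =>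
    refine kerPn_succ_pos lam mu zeta xi rstar hsigma (k + 2) x hB
      (U := Set.Ici (-drift lam mu zeta xi rstar x)) (by simp) fun t ht => ih _ ?_
    have ht' : -drift lam mu zeta xi rstar x ≤ t := ht
    rw [nextZ_step, max_eq_right (by linarith), zero_add, ← mul_assoc, ← pow_succ]
    exact hx

/-- A set of positive measure in the closed upper half-plane has positive measure strictly above
some positive height. -/
theorem exists_pos_volume_inter_lt_ne_zero {B : Set (ℝ × ℝ)} (hB : B ⊆ {p | 0 ≤ p.2})
    (h : volume B ≠ 0) : ∃ ε > 0, volume (B ∩ {p | ε < p.2}) ≠ 0 := by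
  by_contra! H
  have hline : volume {p : ℝ × ℝ | p.2 = 0} = 0 := by
    have : {p : ℝ × ℝ | p.2 = 0} = Set.univ ×ˢ {0} := by
      ext
      simp
    rw [this, Measure.volume_eq_prod, Measure.prod_prod]
    simp
  refine h (measure_mono_null (fun p hp => ?_) (measure_union_null hline
    (measure_iUnion_null fun n : ℕ => H (1 / (n + 1)) Nat.one_div_pos_of_nat)))
  have hp0 : 0 ≤ p.2 := hB hp
  rcases hp0.eq_or_lt with h0 | h0
  · exact Or.inl h0.symm
  · obtain ⟨n, hn⟩ := exists_nat_one_div_lt h0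
    exact Or.inr (Set.mem_iUnion.2 ⟨n, hp, hn⟩)

/-- Lemma 3.2, φ-irreducibility. Suppose `λ + μ > 0`. Fix a finite closed
interval `I = [i₁, i₂]` and `a > 0`, let `E = I × [0,a]` and `φ_E(A) = Leb(A ∩ E)`. Then from
every `x ∈ S`, every Borel `B ⊆ S` with `φ_E(B) > 0` is reached with positive probability in
some finite number `n ≥ 1` of steps. -/
theorem phi_irreducible
    (lam mu zeta xi rstar sigma : ℝ)
    (hlam : 0 < lam) (hzeta : 0 < zeta) (hxi : 0 < xi) (hrstar : zeta < rstar)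
    (hsigma : 0 < sigma) (hlm : 0 < lam + mu)
    (i1 i2 a : ℝ) (ha : 0 < a) :
    ∀ x : ℝ × ℝ, 0 ≤ x.2 →
      ∀ B : Set (ℝ × ℝ), MeasurableSet B → B ⊆ {p | 0 ≤ p.2} →
        0 < volume (B ∩ (Set.Icc i1 i2 ×ˢ Set.Icc (0 : ℝ) a)) →
        ∃ n : ℕ, 1 ≤ n ∧ 0 < kerPn lam mu zeta xi rstar sigma n x B := by
  intro x _ B hB hBS hBE
  obtain ⟨ε, hε, hBε⟩ := exists_pos_volume_inter_lt_ne_zero hBS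
    fun h0 => hBE.ne' (measure_mono_null Set.inter_subset_left h0)
  rcases le_or_gt 0 (1 - lam - mu) with hq | hq
  · have hlim : Tendsto (fun k : ℕ => (1 - lam - mu) ^ (k + 1) * nextZ lam mu x) atTop
        (nhds 0) := by
      simpa using ((tendsto_pow_atTop_nhds_zero_of_lt_one hq (by linarith)).comp
        (tendsto_add_atTop_nat 1)).mul_const (nextZ lam mu x)
    obtain ⟨k, hk⟩ := (hlim.eventually_le_const hε).exists
    exact ⟨k + 2, by lia, kerPn_pos_of_pow_lt lam mu zeta xi rstar hsigma hB hBε k x hk⟩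
  · have two_pos (y : ℝ × ℝ) (hy : 0 ≤ nextZ lam mu y) :
        0 < kerPn lam mu zeta xi rstar sigma 2 y B := by
      refine kerPn_pos_of_pow_lt lam mu zeta xi rstar hsigma hB hBε 0 y ?_
      rw [zero_add, pow_one]
      exact (mul_nonpos_of_nonpos_of_nonneg hq.le hy).trans hε.le
    rcases le_or_gt 0 (nextZ lam mu x) with hx | hx
    · exact ⟨2, by lia, two_pos x hx⟩
    · refine ⟨3, by lia, kerPn_succ_pos lam mu zeta xi rstar hsigma 2 x hB
        (U := Set.univ) (by simp) fun t _ => two_pos _ ?_⟩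
      rw [nextZ_step]
      exact add_nonneg (le_max_right _ _) (mul_nonneg_of_nonpos_of_nonpos hq.le hx.le)
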